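/- arXiv:1002.3221 — 2 statements merged into one kernel-verified Lean document; each statement's English description precedes it below -/
import Mathlib

section
/- For every odd positive integer n and every integer k ≥ 1, one has the polynomial identity R_{2^k·n}(X) = 2^{k−1}·(1 − X^{2^{k−1}·n})·R_n(−X^{2^{k−1}}) in ℤ[X]. -/
open Polynomial Finset

/-- Ramanujan sum `c_n(k) = ∑_{d ∣ gcd(n,k)} d·μ(n/d)`. -/
noncomputable def ramanujanSum (n k : ℕ) : ℤ :=
  ∑ d ∈ (Nat.gcd n k).divisors, (d : ℤ) * ArithmeticFunction.moebius (n / d)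

/-- `R_n(X) = ∑_{k=0}^{n-1} c_n(k) X^k`. -/
noncomputable def R (n : ℕ) : Polynomial ℤ :=
  ∑ k ∈ Finset.range n, C (ramanujanSum n k) * X ^ k

theorem ramanujanSum_eq_sum_ite {n : ℕ} (hn : n ≠ 0) (k : ℕ) :
    ramanujanSum n k =
      ∑ d ∈ n.divisors, if d ∣ k then (d : ℤ) * ArithmeticFunction.moebius (n / d) else 0 := by
  rw [ramanujanSum, ← sum_filter]
  refine sum_congr ?_ fun _ _ => rfl
  ext d
  simp [Nat.dvd_gcd_iff, hn]

theorem ramanujanSum_add_self (n k : ℕ) : ramanujanSum n (k + n) = ramanujanSum n k := by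
  simp [ramanujanSum]

theorem ramanujanSum_mul_right_of_coprime {n a : ℕ} (h : a.Coprime n) (k : ℕ) :
    ramanujanSum n (a * k) = ramanujanSum n k := by
  rw [ramanujanSum, ramanujanSum, h.gcd_mul_left_cancel_right]

theorem ramanujanSum_mul_of_coprime {m n : ℕ} (h : m.Coprime n) (k : ℕ) :
    ramanujanSum (m * n) k = ramanujanSum m k * ramanujanSum n k := by
  have hgcd : (m.gcd k).Coprime (n.gcd k) :=
    (h.coprime_dvd_left (Nat.gcd_dvd_left m k)).coprime_dvd_right (Nat.gcd_dvd_left n k)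
  rw [ramanujanSum, Nat.gcd_comm, h.gcd_mul, Nat.gcd_comm k m, Nat.gcd_comm k n,
    Nat.divisors_mul, Finset.mul_def, sum_image hgcd.mul_injOn_divisors, sum_product,
    ramanujanSum, ramanujanSum, sum_mul_sum]
  refine sum_congr rfl fun a ha => sum_congr rfl fun b hb => ?_
  have ham : a ∣ m := (Nat.dvd_of_mem_divisors ha).trans (Nat.gcd_dvd_left m k)
  have hbn : b ∣ n := (Nat.dvd_of_mem_divisors hb).trans (Nat.gcd_dvd_left n k)
  rw [Nat.mul_div_mul_comm ham hbn,
    ArithmeticFunction.isMultiplicative_moebius.map_mul_of_coprime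
      ((h.coprime_dvd_left (Nat.div_dvd_of_dvd ham)).coprime_dvd_right (Nat.div_dvd_of_dvd hbn))]
  push_cast
  ring

theorem ramanujanSum_two_pow_succ (t l : ℕ) :
    ramanujanSum (2 ^ (t + 1)) l =
      (if 2 ^ (t + 1) ∣ l then 2 ^ (t + 1) else 0) - if 2 ^ t ∣ l then 2 ^ t else 0 := by
  rw [ramanujanSum_eq_sum_ite (by positivity), Nat.sum_divisors_prime_pow Nat.prime_two,
    sum_range_succ, sum_range_succ, sum_eq_zero]
  · have h : 2 ^ (t + 1) / 2 ^ t = 2 := by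
      rw [Nat.pow_div (by omega) two_pos]; simp
    simp [h, ArithmeticFunction.moebius_apply_prime Nat.prime_two]
    split_ifs <;> ring
  · intro i hi
    have hi : i < t := mem_range.mp hi
    rw [Nat.pow_div (by omega) two_pos,
      ArithmeticFunction.moebius_apply_prime_pow Nat.prime_two (by omega), if_neg (show t + 1 - i ≠ 1 by omega)]
    simp

theorem ramanujanSum_two_pow_succ_mul (t i : ℕ) :
    ramanujanSum (2 ^ (t + 1)) (2 ^ t * i) = 2 ^ t * (-1) ^ i := by
  rw [ramanujanSum_two_pow_succ, if_pos (dvd_mul_right (2 ^ t) i)]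
  have hdvd : 2 ^ (t + 1) ∣ 2 ^ t * i ↔ 2 ∣ i := by
    rw [pow_succ, Nat.mul_dvd_mul_iff_left (by positivity)]
  simp only [hdvd]
  rcases Nat.even_or_odd i with h | h
  · rw [if_pos h.two_dvd, h.neg_one_pow]; ring
  · rw [if_neg h.not_two_dvd_nat, h.neg_one_pow]; ring

theorem ramanujanSum_two_pow_succ_of_not_dvd {t l : ℕ} (h : ¬2 ^ t ∣ l) :
    ramanujanSum (2 ^ (t + 1)) l = 0 := by
  rw [ramanujanSum_two_pow_succ, if_neg h,
    if_neg fun h' => h ((pow_dvd_pow 2 t.le_succ).trans h'), sub_zero]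

/-- For every odd positive integer `n` and `k ≥ 1`,
`R_{2^k n}(X) = 2^{k-1}·(1 - X^{2^{k-1} n})·R_n(-X^{2^{k-1}})` in `ℤ[X]`. -/
theorem R_two_pow_mul_of_odd (n k : ℕ) (hn : 0 < n) (hodd : Odd n) (hk : 1 ≤ k) :
    R (2 ^ k * n) =
      C ((2 : ℤ) ^ (k - 1)) * (1 - X ^ (2 ^ (k - 1) * n)) * (R n).comp (-(X ^ 2 ^ (k - 1))) := by
  obtain ⟨t, rfl⟩ : ∃ t, k = t + 1 := ⟨k - 1, by omega⟩
  have hcop (s : ℕ) : (2 ^ s).Coprime n := (Nat.coprime_two_left.mpr hodd).pow_left s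
  have hsub : (range (2 * n)).image (2 ^ t * ·) ⊆ range (2 ^ (t + 1) * n) := by
    intro l hl
    obtain ⟨i, hi, rfl⟩ := mem_image.mp hl
    rw [mem_range] at hi ⊢
    rw [pow_succ, mul_assoc]
    exact Nat.mul_lt_mul_of_pos_left hi (by positivity)
  have hinj : Function.Injective (2 ^ t * · : ℕ → ℕ) := mul_right_injective₀ (by positivity)
  rw [Nat.add_sub_cancel, R, ← sum_subset hsub, sum_image hinj.injOn, two_mul, sum_range_add,
    ← sum_add_distrib, R, Polynomial.sum_comp, mul_sum]
  · refine sum_congr rfl fun i _ => ?_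
    have hcoeff (j : ℕ) : ramanujanSum (2 ^ (t + 1) * n) (2 ^ t * j) =
        2 ^ t * (-1) ^ j * ramanujanSum n j := by
      rw [ramanujanSum_mul_of_coprime (hcop _), ramanujanSum_two_pow_succ_mul,
        ramanujanSum_mul_right_of_coprime (hcop t)]
    rw [hcoeff, hcoeff, add_comm n i, ramanujanSum_add_self, pow_add (-1 : ℤ), hodd.neg_one_pow]
    simp only [C_mul, C_pow, C_neg, C_1, mul_comp, C_comp, pow_comp, X_comp,
      neg_pow (X ^ 2 ^ t : ℤ[X])]
    ring
  · intro l hl hl'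
    have hndvd : ¬2 ^ t ∣ l := by
      rintro ⟨i, rfl⟩
      refine hl' (mem_image_of_mem _ (mem_range.mpr ?_))
      rw [mem_range, pow_succ, mul_assoc] at hl
      exact Nat.lt_of_mul_lt_mul_left hl
    rw [ramanujanSum_mul_of_coprime (hcop _), ramanujanSum_two_pow_succ_of_not_dvd hndvd]
    simp
end

section
/- For every integer k ≥ 1 and every integer m > 1, the polynomial 1 + X^{2^{k−1}} divides R_{2^k·m}(X) in ℤ[X]. -/
open Polynomial Finset

/-- A sum over the multiples of `d` below `d * e`, reindexed by the quotient. -/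
theorem sum_range_mul_ite_dvd {A : Type*} [AddCommMonoid A] (d e : ℕ) (hd : 0 < d) (f : ℕ → A) :
    ∑ j ∈ range (d * e), (if d ∣ j then f j else 0) = ∑ i ∈ range e, f (d * i) := by
  rw [← Finset.sum_filter]
  refine Finset.sum_nbij' (fun j => j / d) (fun i => d * i) ?_ ?_ ?_ ?_ ?_
  · intro j hj
    simp only [mem_filter, mem_range] at hj ⊢
    exact Nat.div_lt_of_lt_mul hj.1
  · intro i hi
    simp only [mem_filter, mem_range] at hi ⊢
    exact ⟨Nat.mul_lt_mul_of_pos_left hi hd, dvd_mul_right _ _⟩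
  · intro j hj
    exact Nat.mul_div_cancel' (mem_filter.1 hj).2
  · intro i _
    exact Nat.mul_div_cancel_left i hd
  · intro j hj
    rw [Nat.mul_div_cancel' (mem_filter.1 hj).2]

/-- The powers of a primitive `q`-th root of unity with exponents the multiples of `d` below `n`
sum to `n / d` if `q ∣ d`, and to `0` otherwise. -/
theorem IsPrimitiveRoot.sum_range_ite_dvd_pow {K : Type*} [Field K] {ζ : K} {q n d : ℕ}
    (hζ : IsPrimitiveRoot ζ q) (hqn : q ∣ n) (hdn : d ∣ n) (hn : n ≠ 0) :
    ∑ j ∈ range n, (if d ∣ j then ζ ^ j else 0) = if q ∣ d then ((n / d : ℕ) : K) else 0 := by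
  obtain ⟨e, rfl⟩ := hdn
  have hd : 0 < d := Nat.pos_of_ne_zero (left_ne_zero_of_mul hn)
  rw [sum_range_mul_ite_dvd d e hd, Nat.mul_div_cancel_left e hd]
  simp_rw [pow_mul]
  split_ifs with h
  · simp [(hζ.pow_eq_one_iff_dvd d).2 h]
  · have h1 : ζ ^ d - 1 ≠ 0 := fun h0 => h ((hζ.pow_eq_one_iff_dvd d).1 (sub_eq_zero.1 h0))
    refine (mul_eq_zero.1 ?_).resolve_right h1
    rw [geom_sum_mul, ← pow_mul, (hζ.pow_eq_one_iff_dvd _).2 hqn, sub_self]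

theorem ramanujanSum_eq_sum_divisors {n : ℕ} (hn : n ≠ 0) (j : ℕ) :
    ramanujanSum n j =
      ∑ d ∈ n.divisors, if d ∣ j then (d : ℤ) * ArithmeticFunction.moebius (n / d) else 0 := by
  rw [ramanujanSum, ← Finset.sum_filter]
  congr 1
  ext d
  simp [Nat.dvd_gcd_iff, hn]

theorem aeval_R_of_isPrimitiveRoot {K : Type*} [Field K] {ζ : K} {q m : ℕ}
    (hζ : IsPrimitiveRoot ζ q) (hq : q ≠ 0) (hm : m ≠ 0) (hm1 : m ≠ 1) :
    aeval ζ (R (q * m)) = 0 := by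
  have hn : q * m ≠ 0 := mul_ne_zero hq hm
  have hfilter : (q * m).divisors.filter (fun e => q ∣ q * m / e) = m.divisors := by
    ext e
    simp only [mem_filter, Nat.mem_divisors]
    constructor
    · rintro ⟨⟨⟨f, hf⟩, -⟩, h⟩
      have he : 0 < e := Nat.pos_of_ne_zero (by rintro rfl; simp [hq, hm] at hf)
      rw [hf, Nat.mul_div_cancel_left f he] at h
      obtain ⟨g, rfl⟩ := h
      refine ⟨⟨g, Nat.eq_of_mul_eq_mul_left (Nat.pos_of_ne_zero hq) ?_⟩, hm⟩
      rw [hf]; ring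
    · rintro ⟨h, -⟩
      exact ⟨⟨h.mul_left q, hn⟩, by rw [Nat.mul_div_assoc q h]; exact dvd_mul_right _ _⟩
  calc aeval ζ (R (q * m))
      = ∑ j ∈ range (q * m), ∑ d ∈ (q * m).divisors,
          ((d : K) * (ArithmeticFunction.moebius (q * m / d) : ℤ)) *
            (if d ∣ j then ζ ^ j else 0) := by
        rw [R, map_sum]
        refine Finset.sum_congr rfl fun j _ => ?_
        rw [ramanujanSum_eq_sum_divisors hn, map_mul, aeval_C, map_pow, aeval_X, map_sum,
          Finset.sum_mul]
        refine Finset.sum_congr rfl fun d _ => ?_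
        split_ifs <;> simp
    _ = ∑ d ∈ (q * m).divisors, ((d : K) * (ArithmeticFunction.moebius (q * m / d) : ℤ)) *
          (if q ∣ d then ((q * m / d : ℕ) : K) else 0) := by
        rw [Finset.sum_comm]
        refine Finset.sum_congr rfl fun d hd => ?_
        rw [← Finset.mul_sum, hζ.sum_range_ite_dvd_pow (dvd_mul_right q m)
          (Nat.dvd_of_mem_divisors hd) hn]
    _ = ∑ e ∈ (q * m).divisors, if q ∣ q * m / e then
          ((q * m : ℕ) : K) * (ArithmeticFunction.moebius e : ℤ) else 0 := by
        rw [← Nat.sum_div_divisors]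
        refine Finset.sum_congr rfl fun e he => ?_
        have hdvd := Nat.dvd_of_mem_divisors he
        rw [Nat.div_div_self hdvd hn]
        split_ifs
        · conv_rhs => rw [← Nat.div_mul_cancel hdvd, Nat.cast_mul]
          ring
        · simp
    _ = ((q * m : ℕ) : K) * ((∑ e ∈ m.divisors, ArithmeticFunction.moebius e : ℤ) : K) := by
        rw [← Finset.sum_filter, hfilter, ← Finset.mul_sum, Int.cast_sum]
    _ = 0 := by
        rw [← ArithmeticFunction.coe_mul_zeta_apply, ArithmeticFunction.moebius_mul_coe_zeta,
          ArithmeticFunction.one_apply_ne hm1, Int.cast_zero, mul_zero]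

/-- For every `k ≥ 1` and `m > 1`, the polynomial `1 + X^{2^{k-1}}` divides `R_{2^k m}` in `ℤ[X]`. -/
theorem one_add_X_pow_dvd_R (k m : ℕ) (hk : 1 ≤ k) (hm : 1 < m) :
    (1 + X ^ 2 ^ (k - 1)) ∣ R (2 ^ k * m) := by
  have hq : 2 ^ k ≠ 0 := by positivity
  have hζ := Complex.isPrimitiveRoot_exp (2 ^ k) hq
  have hcyc : cyclotomic (2 ^ k) ℤ = 1 + X ^ 2 ^ (k - 1) := by
    obtain ⟨l, rfl⟩ := Nat.exists_eq_add_of_le' hk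
    simp [cyclotomic_prime_pow_eq_geom_sum Nat.prime_two, Finset.sum_range_succ]
  rw [← hcyc, cyclotomic_eq_minpoly hζ (Nat.pos_of_ne_zero hq)]
  exact minpoly.isIntegrallyClosed_dvd (hζ.isIntegral (Nat.pos_of_ne_zero hq))
    (aeval_R_of_isPrimitiveRoot hζ hq (by omega) (by omega))
end
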